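/- In the conditional front-door SCM, for every q* ∈ Q and r ∈ R, the interventional distribution of the reasoning variable under do(Q=q*), defined as P(r | do(Q=q*)) := Σ_{u∈U} Σ_{e∈E} pU(u)·pE(e)·pR(q*)(e)(r), equals the e-mixture of observational conditionals: P(r | do(Q=q*)) = Σ_{e∈E} pE(e) · P_obs(r | q*, e), provided that P_obs(q*, e) > 0 for every e ∈ E. -/

import Mathlib

open Finset

variable {U E Q R A : Type*} [Fintype U] [Fintype E] [Fintype Q] [Fintype R] [Fintype A]

/-- Observational joint distribution of the conditional front-door SCM:
`p(u, e, q, r, a) = pU(u) * pE(e) * pQ(u)(e)(q) * pR(q)(e)(r) * pA(r)(u)(e)(a)`. -/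
def cfdJoint (pU : U → ℝ) (pE : E → ℝ) (pQ : U → E → Q → ℝ) (pR : Q → E → R → ℝ)
    (pA : R → U → E → A → ℝ) (u : U) (e : E) (q : Q) (r : R) (a : A) : ℝ :=
  pU u * pE e * pQ u e q * pR q e r * pA r u e a

/-- Observational marginal `P_obs(e)`. -/
def cfdPe (pU : U → ℝ) (pE : E → ℝ) (pQ : U → E → Q → ℝ) (pR : Q → E → R → ℝ)
    (pA : R → U → E → A → ℝ) (e : E) : ℝ :=
  ∑ u, ∑ q, ∑ r, ∑ a, cfdJoint pU pE pQ pR pA u e q r a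

/-- Observational marginal `P_obs(q, e)`. -/
def cfdPqe (pU : U → ℝ) (pE : E → ℝ) (pQ : U → E → Q → ℝ) (pR : Q → E → R → ℝ)
    (pA : R → U → E → A → ℝ) (q : Q) (e : E) : ℝ :=
  ∑ u, ∑ r, ∑ a, cfdJoint pU pE pQ pR pA u e q r a

/-- Observational marginal `P_obs(r, q, e)`. -/
def cfdPrqe (pU : U → ℝ) (pE : E → ℝ) (pQ : U → E → Q → ℝ) (pR : Q → E → R → ℝ)
    (pA : R → U → E → A → ℝ) (r : R) (q : Q) (e : E) : ℝ :=
  ∑ u, ∑ a, cfdJoint pU pE pQ pR pA u e q r a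

/-- The marginal of the variables `(r, q, e)` factors through the mechanism of `r`. -/
theorem cfdPrqe_eq (pU : U → ℝ) (pE : E → ℝ) (pQ : U → E → Q → ℝ) (pR : Q → E → R → ℝ)
    (pA : R → U → E → A → ℝ) (hA1 : ∀ r u e, ∑ a, pA r u e a = 1) (r : R) (q : Q) (e : E) :
    cfdPrqe pU pE pQ pR pA r q e = (∑ u, pU u * pE e * pQ u e q) * pR q e r := by
  simp only [cfdPrqe, cfdJoint, ← mul_sum, hA1, mul_one, ← sum_mul]

/-- The marginal of the variables `(q, e)` does not involve the mechanisms of `r` and `a`. -/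
theorem cfdPqe_eq (pU : U → ℝ) (pE : E → ℝ) (pQ : U → E → Q → ℝ) (pR : Q → E → R → ℝ)
    (pA : R → U → E → A → ℝ) (hR1 : ∀ q e, ∑ r, pR q e r = 1)
    (hA1 : ∀ r u e, ∑ a, pA r u e a = 1) (q : Q) (e : E) :
    cfdPqe pU pE pQ pR pA q e = ∑ u, pU u * pE e * pQ u e q := by
  simp only [cfdPqe, cfdJoint, ← mul_sum, hA1, hR1, mul_one]

/-- In the conditional front-door SCM, for every `q*` and `r`, the interventional
distribution of the reasoning variable under `do(Q = q*)`,
`P(r | do(Q = q*)) = ∑ u, ∑ e, pU(u) * pE(e) * pR(q*)(e)(r)`, equals the `e`-mixture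
of observational conditionals `∑ e, pE(e) * P_obs(r | q*, e)`, provided
`P_obs(q*, e) > 0` for every `e`. -/
theorem conditional_front_door_mediator_interventional
    [Nonempty U] [Nonempty E] [Nonempty Q] [Nonempty R] [Nonempty A]
    (pU : U → ℝ) (pE : E → ℝ) (pQ : U → E → Q → ℝ) (pR : Q → E → R → ℝ)
    (pA : R → U → E → A → ℝ)
    (hpU : ∀ u, 0 ≤ pU u) (hpE : ∀ e, 0 ≤ pE e)
    (hpQ : ∀ u e q, 0 ≤ pQ u e q) (hpR : ∀ q e r, 0 ≤ pR q e r)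
    (hpA : ∀ r u e a, 0 ≤ pA r u e a)
    (hU1 : ∑ u, pU u = 1) (hE1 : ∑ e, pE e = 1)
    (hQ1 : ∀ u e, ∑ q, pQ u e q = 1) (hR1 : ∀ q e, ∑ r, pR q e r = 1)
    (hA1 : ∀ r u e, ∑ a, pA r u e a = 1)
    (qstar : Q) (r : R)
    (hqe : ∀ e : E, 0 < cfdPqe pU pE pQ pR pA qstar e) :
    (∑ u, ∑ e, pU u * pE e * pR qstar e r) =
      ∑ e, pE e * (cfdPrqe pU pE pQ pR pA r qstar e / cfdPqe pU pE pQ pR pA qstar e) := by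
  have h_cond (e : E) :
      cfdPrqe pU pE pQ pR pA r qstar e / cfdPqe pU pE pQ pR pA qstar e = pR qstar e r := by
    rw [div_eq_iff (hqe e).ne', cfdPrqe_eq pU pE pQ pR pA hA1,
      cfdPqe_eq pU pE pQ pR pA hR1 hA1, mul_comm]
  simp only [h_cond, mul_assoc, ← mul_sum, ← sum_mul, hU1, one_mul]
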